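/- Let P = ℕ ∪ {a}, where ℕ carries its usual order, a ∉ ℕ, and a is incomparable with every natural number. Then P is a consistent dcpo, but the Scott space (P, σ(P)) is not a d*-space. -/

import Mathlib

open Set
/-- The specialization order on a topological space: `x ≤ y` iff `x ∈ closure {y}`. -/
def specLE {X : Type*} [TopologicalSpace X] (x y : X) : Prop := x ∈ closure {y}

/-- The upper closure `↑x = {y | x ≤ y}` of a point in the specialization order. -/
def upSet {X : Type*} [TopologicalSpace X] (x : X) : Set X := {y | specLE x y}

/-- A `T₀` space `X` is a *d\*-space* if for every (nonempty) directed subset `D` of `X`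
(in the specialization order), every `x ∈ X` and every nonempty open `U`,
`⋂_{d ∈ D} ↑d ∩ ↑x ⊆ U` implies `↑d ∩ ↑x ⊆ U` for some `d ∈ D`. -/
def IsDStarSpace (X : Type*) [TopologicalSpace X] : Prop :=
  ∀ D : Set X, D.Nonempty → DirectedOn specLE D → ∀ x : X, ∀ U : Set X,
    IsOpen U → U.Nonempty →
    (⋂ d ∈ D, upSet d) ∩ upSet x ⊆ U → ∃ d ∈ D, upSet d ∩ upSet x ⊆ U
/-- The Scott topology on a preorder: opens are the upper sets `U` such that every
directed set having a least upper bound in `U` meets `U`. -/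
def scottTopology (P : Type*) [Preorder P] : TopologicalSpace P where
  IsOpen U := IsUpperSet U ∧
    ∀ D : Set P, D.Nonempty → DirectedOn (· ≤ ·) D → ∀ a : P, IsLUB D a → a ∈ U →
      (D ∩ U).Nonempty
  isOpen_univ :=
    ⟨isUpperSet_univ, fun _ hD _ _ _ _ => hD.imp fun _ hd => ⟨hd, trivial⟩⟩
  isOpen_inter U V hU hV := by
    refine ⟨hU.1.inter hV.1, fun D hD hdir a ha haUV => ?_⟩
    obtain ⟨d₁, hd₁D, hd₁U⟩ := hU.2 D hD hdir a ha haUV.1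
    obtain ⟨d₂, hd₂D, hd₂V⟩ := hV.2 D hD hdir a ha haUV.2
    obtain ⟨d₃, hd₃D, h₁₃, h₂₃⟩ := hdir d₁ hd₁D d₂ hd₂D
    exact ⟨d₃, hd₃D, hU.1 h₁₃ hd₁U, hV.1 h₂₃ hd₂V⟩
  isOpen_sUnion S hS := by
    refine ⟨isUpperSet_sUnion fun U hU => (hS U hU).1, fun D hD hdir a ha haS => ?_⟩
    obtain ⟨U, hUS, haU⟩ := haS
    obtain ⟨d, hdD, hdU⟩ := (hS U hUS).2 D hD hdir a ha haU
    exact ⟨d, hdD, U, hUS, hdU⟩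

theorem specLE_scottTopology_iff {P : Type*} [Preorder P] {x y : P} :
    @specLE P (scottTopology P) x y ↔ x ≤ y := by
  let _ : TopologicalSpace P := scottTopology P
  change x ∈ closure {y} ↔ x ≤ y
  rw [mem_closure_iff]
  refine ⟨fun h => ?_, fun hxy U hU hx => ⟨y, hU.1 hxy hx, rfl⟩⟩
  by_contra hxy
  have hopen : IsOpen (Set.Iic y)ᶜ := by
    refine ⟨(isLowerSet_Iic y).compl, fun D _ _ a ha haU => ?_⟩
    by_contra hD
    refine haU (ha.2 fun d hd => ?_)
    by_contra hdy
    exact hD ⟨d, hd, hdy⟩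
  obtain ⟨z, hz, rfl⟩ := h _ hopen hxy
  exact hz le_rfl

theorem isOpen_scottTopology_range_inr {α : Type*} [Preorder α] :
    @IsOpen (α ⊕ Unit) (scottTopology (α ⊕ Unit)) (Set.range Sum.inr) := by
  refine ⟨?_, ?_⟩
  · rintro _ (b | b) h ⟨u, rfl⟩
    · exact absurd h Sum.not_inr_le_inl
    · exact ⟨b, rfl⟩
  · rintro D ⟨d, hd⟩ - _ ha ⟨u, rfl⟩
    refine ⟨d, hd, ?_⟩
    have hle := ha.1 hd
    cases d with
    | inl n => exact absurd hle Sum.not_inl_le_inr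
    | inr v => exact ⟨v, rfl⟩

theorem exists_isLUB_nat_sum_unit {D : Set (ℕ ⊕ Unit)} (hne : D.Nonempty)
    (hbdd : BddAbove D) : ∃ a, IsLUB D a := by
  classical
  obtain ⟨d, hd⟩ := hne
  cases d with
  | inl k =>
    have hex : ∃ n : ℕ, Sum.inl n ∈ upperBounds D := by
      obtain ⟨b | b, hb⟩ := hbdd
      · exact ⟨b, hb⟩
      · exact absurd (hb hd) Sum.not_inl_le_inr
    refine ⟨Sum.inl (Nat.find hex), Nat.find_spec hex, ?_⟩
    rintro (c | c) hc
    · exact Sum.inl_le_inl_iff.2 (Nat.find_min' hex hc)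
    · exact absurd (hc hd) Sum.not_inl_le_inr
  | inr u =>
    obtain ⟨b | b, hb⟩ := hbdd
    · exact absurd (hb hd) Sum.not_inr_le_inl
    · exact ⟨Sum.inr u, hb, fun c hc => hc hd⟩

/-- Let `P = ℕ ∪ {a}` where `ℕ` has its usual order and `a` is incomparable with every
natural number (formalized as the disjoint-sum order on `ℕ ⊕ Unit`).  Then `P` is a
consistent dcpo (every directed set with a nonempty set of upper bounds has a least upper
bound), but the Scott space `(P, σ(P))` is not a d*-space. -/
theorem sum_consistent_dcpo_not_dstar :
    (∀ D : Set (ℕ ⊕ Unit), D.Nonempty → DirectedOn (· ≤ ·) D →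
      (⋂ d ∈ D, Set.Ici d).Nonempty → ∃ a : ℕ ⊕ Unit, IsLUB D a) ∧
    ¬ @IsDStarSpace (ℕ ⊕ Unit) (scottTopology (ℕ ⊕ Unit)) := by
  refine ⟨fun D hne _ ⟨b, hb⟩ =>
    exists_isLUB_nat_sum_unit hne ⟨b, fun d hd => Set.mem_iInter₂.1 hb d hd⟩, fun h => ?_⟩
  have hdir : @DirectedOn (ℕ ⊕ Unit) (@specLE _ (scottTopology (ℕ ⊕ Unit)))
      (Set.range Sum.inl) := by
    rintro _ ⟨m, rfl⟩ _ ⟨n, rfl⟩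
    exact ⟨_, ⟨max m n, rfl⟩,
      specLE_scottTopology_iff.2 (Sum.inl_le_inl_iff.2 (le_max_left m n)),
      specLE_scottTopology_iff.2 (Sum.inl_le_inl_iff.2 (le_max_right m n))⟩
  obtain ⟨_, ⟨n, rfl⟩, hn⟩ := h (Set.range Sum.inl) (Set.range_nonempty _) hdir (Sum.inl 0)
    (Set.range Sum.inr) isOpen_scottTopology_range_inr (Set.range_nonempty _) (by
      rintro (m | u) ⟨hm, -⟩
      · have hle := specLE_scottTopology_iff.1
          (Set.mem_iInter₂.1 hm (Sum.inl (m + 1)) ⟨_, rfl⟩)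
        exact absurd (Sum.inl_le_inl_iff.1 hle) m.not_succ_le_self
      · exact ⟨u, rfl⟩)
  obtain ⟨u, hu⟩ := hn (a := Sum.inl n)
    ⟨specLE_scottTopology_iff.2 le_rfl,
      specLE_scottTopology_iff.2 (Sum.inl_le_inl_iff.2 n.zero_le)⟩
  cases hu
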